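/- arXiv:1601.01000 — 3 statements merged into one kernel-verified Lean document; each statement's English description precedes it below -/
import Mathlib

section
/- Suppose S̃₁, S̃₂ satisfy condition C1 with constant κ > 0 and condition C2 with constant κ > 0. Fix h ∈ ℝ^{n+1} and let CN(C₁(h)) := {α N₁(ζ) : ζ ∈ C₁(h), α ∈ ℝ} be the cone through the origin generated by the unit normals to S̃₁ at points of C₁(h). Then for every ζ₂ ∈ S̃₂ and every p ∈ ℝ^{n+1}, the line {p + s N₂(ζ₂) : s ∈ ℝ} intersects CN(C₁(h)) in at most one point. Equivalently: if ζ, ζ' ∈ C₁(h) and α, β, s ∈ ℝ satisfy α N₁(ζ) − β N₁(ζ') = s N₂(ζ₂), then α N₁(ζ) = β N₁(ζ'). -/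
open MeasureTheory Metric Set
open scoped ENNReal NNReal ContDiff

noncomputable section

local notation "⟪" x ", " y "⟫" => @inner ℝ _ _ x y

/-- Euclidean space `ℝ^m`. -/
abbrev Eu (m : ℕ) : Type := EuclideanSpace ℝ (Fin m)

/-- The point `(ξ, φ ξ)` on the graph of `φ`, viewed as an element of `ℝ^{n+1}`. -/
def graphPt (n : ℕ) (φ : Eu n → ℝ) (ξ : Eu n) : Eu (n + 1) :=
  (EuclideanSpace.equiv (Fin (n + 1)) ℝ).symm (Fin.snoc (fun i => ξ i) (φ ξ))

/-- The (non-normalized) upward normal `(−∇φ ξ, 1)` of the graph of `φ` over `ξ`. -/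
def upNormal (n : ℕ) (φ : Eu n → ℝ) (ξ : Eu n) : Eu (n + 1) :=
  (EuclideanSpace.equiv (Fin (n + 1)) ℝ).symm (Fin.snoc (fun i => -(gradient φ ξ) i) 1)

/-- The unit normal `N(ζ) = (−∇φ ξ, 1)/|(−∇φ ξ, 1)|` at the graph point `ζ = (ξ, φ ξ)`. -/
def normalAt (n : ℕ) (φ : Eu n → ℝ) (ξ : Eu n) : Eu (n + 1) :=
  ‖upNormal n φ ξ‖⁻¹ • upNormal n φ ξ

/-- `|u ∧ v|`, the area of the parallelogram spanned by `u` and `v`. -/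
def wedge {m : ℕ} (u v : Eu m) : ℝ :=
  Real.sqrt (‖u‖ ^ 2 * ‖v‖ ^ 2 - ⟪u, v⟫ ^ 2)

/-- `vol(u,v,w)`, the square root of the 3×3 Gram determinant of `u, v, w`. -/
def vol3 {m : ℕ} (u v w : Eu m) : ℝ :=
  Real.sqrt (Matrix.det
    !![⟪u, u⟫, ⟪u, v⟫, ⟪u, w⟫;
       ⟪v, u⟫, ⟪v, v⟫, ⟪v, w⟫;
       ⟪w, u⟫, ⟪w, v⟫, ⟪w, w⟫])

/-- Condition **C1** (uniform transversality) with constant `κ`, for the graphs of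
`φ₁` over `Dt₁` and `φ₂` over `Dt₂`. -/
def CondC1 (n : ℕ) (φ₁ φ₂ : Eu n → ℝ) (Dt₁ Dt₂ : Set (Eu n)) (κ : ℝ) : Prop :=
  ∀ ξ₁ ∈ Dt₁, ∀ ξ₂ ∈ Dt₂, κ ≤ wedge (normalAt n φ₁ ξ₁) (normalAt n φ₂ ξ₂)

/-- Condition **C2** (global dispersion/curvature) with constant `κ`: for `i = 1,2`,
for every `h ∈ ℝ^{n+1}` and all points `ζ, ζ'` of `C_i(h)` (i.e. graph points of `S̃_i`
whose reflection through `h` lies on `S̃_{3-i}`), and all `ζ̃₁ ∈ S̃₁`, `ζ̃₂ ∈ S̃₂`,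
`vol(N_i(ζ) − N_i(ζ'), N₁(ζ̃₁), N₂(ζ̃₂)) ≥ κ|ζ − ζ'|`. -/
def CondC2 (n : ℕ) (φ₁ φ₂ : Eu n → ℝ) (Dt₁ Dt₂ : Set (Eu n)) (κ : ℝ) : Prop :=
  (∀ h : Eu (n + 1), ∀ ξ ∈ Dt₁, ∀ ξ' ∈ Dt₁,
      h - graphPt n φ₁ ξ ∈ graphPt n φ₂ '' Dt₂ →
      h - graphPt n φ₁ ξ' ∈ graphPt n φ₂ '' Dt₂ →
      ∀ η₁ ∈ Dt₁, ∀ η₂ ∈ Dt₂,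
        κ * ‖graphPt n φ₁ ξ - graphPt n φ₁ ξ'‖ ≤
          vol3 (normalAt n φ₁ ξ - normalAt n φ₁ ξ')
            (normalAt n φ₁ η₁) (normalAt n φ₂ η₂)) ∧
  (∀ h : Eu (n + 1), ∀ ξ ∈ Dt₂, ∀ ξ' ∈ Dt₂,
      h - graphPt n φ₂ ξ ∈ graphPt n φ₁ '' Dt₁ →
      h - graphPt n φ₂ ξ' ∈ graphPt n φ₁ '' Dt₁ →
      ∀ η₁ ∈ Dt₁, ∀ η₂ ∈ Dt₂,
        κ * ‖graphPt n φ₂ ξ - graphPt n φ₂ ξ'‖ ≤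
          vol3 (normalAt n φ₂ ξ - normalAt n φ₂ ξ')
            (normalAt n φ₁ η₁) (normalAt n φ₂ η₂))

/-- The free wave `u(x,t) = ∫ e^{i(x·ξ + t φ(ξ))} f(ξ) dξ` with phase `φ` and
Fourier data `f`, as a function of `z = (x,t) ∈ ℝⁿ × ℝ`. -/
def freeWave (n : ℕ) (φ : Eu n → ℝ) (f : Eu n → ℂ) (z : Eu n × ℝ) : ℂ :=
  ∫ ξ : Eu n, Complex.exp (Complex.I * ((⟪z.1, ξ⟫ + z.2 * φ ξ : ℝ) : ℂ)) * f ξ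

/-- The axis-parallel cube in `ℝⁿ × ℝ` with center `z` and side length `L`. -/
def cubeQ (n : ℕ) (z : Eu n × ℝ) (L : ℝ) : Set (Eu n × ℝ) :=
  {w | (∀ i, |w.1 i - z.1 i| ≤ L / 2) ∧ |w.2 - z.2| ≤ L / 2}

/-- The margin of Fourier data `f` relative to the enlarged domain `D`:
the distance from the support of `f` to the complement of `D` (in `ℝ≥0∞`). -/
def marginE (n : ℕ) (f : Eu n → ℂ) (D : Set (Eu n)) : ℝ≥0∞ :=
  ⨅ x ∈ Function.support f, ⨅ y ∈ Dᶜ, edist x y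

/-- Distance between two subsets of `ℝⁿ` (in `ℝ≥0∞`). -/
def setDistE (n : ℕ) (A B : Set (Eu n)) : ℝ≥0∞ :=
  ⨅ x ∈ A, ⨅ y ∈ B, edist x y

/-- The unit normals of the graph of `φ` over `D` vary by at most `ε`. -/
def NormalVarLe (n : ℕ) (φ : Eu n → ℝ) (D : Set (Eu n)) (ε : ℝ) : Prop :=
  ∀ ξ ∈ D, ∀ ξ' ∈ D, ‖normalAt n φ ξ - normalAt n φ ξ'‖ ≤ ε

/-- All iterated derivatives of `φ` of order `≤ K` are bounded by `B` on `D`. -/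
def DerivBound (n K : ℕ) (φ : Eu n → ℝ) (D : Set (Eu n)) (B : ℝ) : Prop :=
  ∀ k ≤ K, ∀ ξ ∈ D, ‖iteratedFDeriv ℝ k φ ξ‖ ≤ B

theorem wedge_smul_right {m : ℕ} (u : Eu m) (c : ℝ) : wedge u (c • u) = 0 := by
  rw [wedge, norm_smul, mul_pow, Real.norm_eq_abs, sq_abs, real_inner_smul_right,
    real_inner_self_eq_norm_sq]
  ring_nf
  exact Real.sqrt_zero

theorem vol3_add_smul_right {m : ℕ} (u v : Eu m) (c d : ℝ) :
    vol3 u v (c • u + d • v) = 0 := by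
  rw [vol3, Matrix.det_fin_three]
  simp only [Matrix.of_apply, Matrix.cons_val, inner_add_left, inner_add_right,
    real_inner_smul_left, real_inner_smul_right, real_inner_comm u v]
  ring_nf
  exact Real.sqrt_zero

theorem graphPt_injective (n : ℕ) (φ : Eu n → ℝ) : Function.Injective (graphPt n φ) := by
  intro ξ ξ' h
  have h' := (EuclideanSpace.equiv (Fin (n + 1)) ℝ).symm.injective h
  ext i
  simpa using congrFun h' i.castSucc

/-- Lemma 1.4 of the paper.  Under conditions C1 and C2 with constant
`κ > 0`, for every `h ∈ ℝ^{n+1}` a line in the direction of a normal `N₂(ζ₂)` of `S̃₂`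
meets the cone `CN(C₁(h)) = {α N₁(ζ) : ζ ∈ C₁(h), α ∈ ℝ}` in at most one point.
Equivalently: if `ζ, ζ' ∈ C₁(h)` and `α N₁(ζ) − β N₁(ζ') = s N₂(ζ₂)`, then
`α N₁(ζ) = β N₁(ζ')`. -/
theorem line_meets_normal_cone_once (n : ℕ) (hn : 2 ≤ n) (κ : ℝ) (hκ : 0 < κ)
    (Dt₁ Dt₂ : Set (Eu n)) (φ₁ φ₂ : Eu n → ℝ)
    (hC1 : CondC1 n φ₁ φ₂ Dt₁ Dt₂ κ) (hC2 : CondC2 n φ₁ φ₂ Dt₁ Dt₂ κ)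
    (h : Eu (n + 1)) (ξ₂ : Eu n) (hξ₂ : ξ₂ ∈ Dt₂)
    (ξ ξ' : Eu n) (hξ : ξ ∈ Dt₁) (hξ' : ξ' ∈ Dt₁)
    (hmem : h - graphPt n φ₁ ξ ∈ graphPt n φ₂ '' Dt₂)
    (hmem' : h - graphPt n φ₁ ξ' ∈ graphPt n φ₂ '' Dt₂)
    (α β s : ℝ)
    (heq : α • normalAt n φ₁ ξ - β • normalAt n φ₁ ξ' = s • normalAt n φ₂ ξ₂) :
    α • normalAt n φ₁ ξ = β • normalAt n φ₁ ξ' := by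
  have hs : s = 0 := by
    by_contra hs
    by_cases hξξ' : ξ = ξ'
    · subst hξξ'
      have hN : normalAt n φ₂ ξ₂ = (s⁻¹ * (α - β)) • normalAt n φ₁ ξ := by
        rw [mul_smul, sub_smul, heq, inv_smul_smul₀ hs]
      have hle := hC1 ξ hξ ξ₂ hξ₂
      rw [hN, wedge_smul_right] at hle
      exact hle.not_gt hκ
    · have hN : normalAt n φ₂ ξ₂ = (s⁻¹ * β) • (normalAt n φ₁ ξ - normalAt n φ₁ ξ') +
          (s⁻¹ * (α - β)) • normalAt n φ₁ ξ := by
        rw [← inv_smul_smul₀ hs (normalAt n φ₂ ξ₂), ← heq]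
        module
      have hle := hC2.1 h ξ hξ ξ' hξ' hmem hmem' ξ hξ ξ₂ hξ₂
      rw [hN, vol3_add_smul_right] at hle
      have hpos : 0 < ‖graphPt n φ₁ ξ - graphPt n φ₁ ξ'‖ :=
        norm_sub_pos_iff.mpr ((graphPt_injective n φ₁).ne hξξ')
      exact hle.not_gt (mul_pos hκ hpos)
  rwa [hs, zero_smul, sub_eq_zero] at heq
end
end

section
/- Let m ≥ 1, let A : ℝᵐ → ℝᵐ be a linear map, let c > 0, and let v, n ∈ ℝᵐ satisfy ⟨v, n⟩ = 0 and |⟨Av, v⟩| ≥ c|v|². Then √(|Av|²|n|² − ⟨Av, n⟩²) ≥ c|v||n|; that is, the area |Av ∧ n| of the parallelogram spanned by Av and n is at least c|v||n|. -/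
noncomputable section

local notation "⟪" x ", " y "⟫" => @inner ℝ _ _ x y

/-- Bessel's inequality for two orthogonal vectors, with denominators cleared. -/
theorem inner_sq_mul_norm_sq_le_of_inner_eq_zero {E : Type*} [NormedAddCommGroup E]
    [InnerProductSpace ℝ E] (w : E) {v n : E} (h : ⟪v, n⟫ = 0) :
    ⟪w, v⟫ ^ 2 * ‖n‖ ^ 2 ≤ (‖w‖ ^ 2 * ‖n‖ ^ 2 - ⟪w, n⟫ ^ 2) * ‖v‖ ^ 2 := by
  rcases eq_or_ne n 0 with rfl | hn
  · simp
  have hN : 0 < ‖n‖ ^ 2 := by positivity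
  have hnv : ⟪n, v⟫ = 0 := by rw [real_inner_comm, h]
  set u := ‖n‖ ^ 2 • w - ⟪w, n⟫ • n with hu
  have huv : ⟪u, v⟫ = ‖n‖ ^ 2 * ⟪w, v⟫ := by
    simp [hu, inner_sub_left, real_inner_smul_left, hnv]
  have huu : ‖u‖ ^ 2 = ‖n‖ ^ 2 * (‖w‖ ^ 2 * ‖n‖ ^ 2 - ⟪w, n⟫ ^ 2) := by
    rw [hu, norm_sub_sq_real, real_inner_smul_left, real_inner_smul_right, norm_smul, norm_smul,
      mul_pow, mul_pow, Real.norm_eq_abs, Real.norm_eq_abs, sq_abs, sq_abs]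
    ring
  have hcs : ⟪u, v⟫ ^ 2 ≤ ‖u‖ ^ 2 * ‖v‖ ^ 2 := by
    rw [← mul_pow]
    exact sq_le_sq.2 ((abs_real_inner_le_norm u v).trans (le_abs_self _))
  rw [huv, huu] at hcs
  refine le_of_mul_le_mul_left ?_ hN
  linarith

/-- the linear-algebra step: the second-fundamental-form lower bound
implies the wedge lower bound.  If `A` is a linear map on `ℝ^m`, `v ⊥ n` and
`|⟨Av, v⟩| ≥ c|v|²`, then the area of the parallelogram spanned by `Av` and `n`
satisfies `|Av ∧ n| = √(|Av|²|n|² − ⟨Av,n⟩²) ≥ c|v||n|`. -/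
theorem shape_operator_wedge_lower_bound (m : ℕ) (hm : 1 ≤ m)
    (A : EuclideanSpace ℝ (Fin m) →ₗ[ℝ] EuclideanSpace ℝ (Fin m))
    (c : ℝ) (hc : 0 < c) (v nv : EuclideanSpace ℝ (Fin m))
    (hortho : ⟪v, nv⟫ = 0) (hA : c * ‖v‖ ^ 2 ≤ |⟪A v, v⟫|) :
    c * ‖v‖ * ‖nv‖ ≤ Real.sqrt (‖A v‖ ^ 2 * ‖nv‖ ^ 2 - ⟪A v, nv⟫ ^ 2) := by
  rcases eq_or_ne v 0 with rfl | hv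
  · simp
  have hV : 0 < ‖v‖ ^ 2 := by positivity
  have hsq : (c * ‖v‖ ^ 2) ^ 2 ≤ ⟪A v, v⟫ ^ 2 :=
    sq_le_sq.2 ((abs_of_nonneg (by positivity : 0 ≤ c * ‖v‖ ^ 2)).le.trans hA)
  refine Real.le_sqrt_of_sq_le (le_of_mul_le_mul_right ?_ hV)
  calc (c * ‖v‖ * ‖nv‖) ^ 2 * ‖v‖ ^ 2 = (c * ‖v‖ ^ 2) ^ 2 * ‖nv‖ ^ 2 := by ring
    _ ≤ ⟪A v, v⟫ ^ 2 * ‖nv‖ ^ 2 := by gcongr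
    _ ≤ _ := inner_sq_mul_norm_sq_le_of_inner_eq_zero (A v) hortho
end
end

section
/- Let n ≥ 1, ξ₀ ∈ ℝⁿ, ρ > 0, and let g ∈ C_c^∞(ℝⁿ, ℂ) be supported in the closed ball B(ξ₀, ρ). Let φ : ℝⁿ → ℝ be smooth and suppose the operator norm of the Hessian of φ is bounded by B on B(ξ₀, ρ). Define u(x,t) = ∫_{ℝⁿ} e^{i(x·ξ + tφ(ξ))} g(ξ) dξ. Then for every t ∈ ℝ, ( ∫_{ℝⁿ} |x + t∇φ(ξ₀)|² |u(x,t)|² dx )^{1/2} ≤ (2π)^{n/2} ( ‖∇g‖_{L²(ℝⁿ)} + |t| ρ B ‖g‖_{L²(ℝⁿ)} ). -/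
open MeasureTheory
open scoped ContDiff

noncomputable section

local notation "⟪" x ", " y "⟫" => @inner ℝ _ _ x y

/-- Minkowski's inequality in `L²`, written with square roots of integrals. -/
theorem sqrt_integral_norm_sq_add_le {α E : Type*} [MeasurableSpace α] {μ : Measure α}
    [NormedAddCommGroup E] {f h : α → E} (hf : MemLp f 2 μ) (hh : MemLp h 2 μ) :
    Real.sqrt (∫ a, ‖f a + h a‖ ^ 2 ∂μ)
      ≤ Real.sqrt (∫ a, ‖f a‖ ^ 2 ∂μ) + Real.sqrt (∫ a, ‖h a‖ ^ 2 ∂μ) := by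
  have key : ∀ k : α → E, MemLp k 2 μ →
      Real.sqrt (∫ a, ‖k a‖ ^ 2 ∂μ) = (eLpNorm k 2 μ).toReal := by
    intro k hk
    rw [hk.eLpNorm_eq_integral_rpow_norm (by norm_num) (by norm_num),
      ENNReal.toReal_ofReal (by positivity), Real.sqrt_eq_rpow]
    norm_num
  rw [key f hf, key h hh, ← ENNReal.toReal_add hf.eLpNorm_ne_top hh.eLpNorm_ne_top]
  refine (key _ (hf.add hh)).trans_le ?_
  exact ENNReal.toReal_mono (ENNReal.add_ne_top.2 ⟨hf.eLpNorm_ne_top, hh.eLpNorm_ne_top⟩)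
    (eLpNorm_add_le hf.1 hh.1 (by norm_num))

open scoped FourierTransform LineDeriv in
/-- Plancherel's identity for the gradient, in the normalization `∫ e^{i y·ξ} G(ξ) dξ`. -/
theorem integral_norm_sq_mul_norm_sq_integral_exp {n : ℕ} (G : SchwartzMap (Eu n) ℂ) :
    ∫ y : Eu n, ‖y‖ ^ 2 *
        ‖∫ ξ : Eu n, Complex.exp (Complex.I * ((⟪y, ξ⟫ : ℝ) : ℂ)) * G ξ‖ ^ 2
      = (2 * Real.pi) ^ n *
          ∫ ξ : Eu n, ∑ j : Fin n, ‖fderiv ℝ G ξ (EuclideanSpace.single j 1)‖ ^ 2 := by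
  set F : Eu n → ℝ := fun y => ‖y‖ ^ 2 *
    ‖∫ ξ : Eu n, Complex.exp (Complex.I * ((⟪y, ξ⟫ : ℝ) : ℂ)) * G ξ‖ ^ 2 with hF
  have hint : ∀ H : SchwartzMap (Eu n) ℂ, Integrable (fun ξ => ‖H ξ‖ ^ 2) := fun H =>
    (H.memLp 2).integrable_norm_pow (by norm_num)
  have hderiv : ∀ (w : Eu n) (j : Fin n),
      ‖𝓕 (∂_{EuclideanSpace.single j (1 : ℝ)} G) w‖ ^ 2
        = (2 * Real.pi) ^ 2 * (‖w j‖ ^ 2 * ‖𝓕 G w‖ ^ 2) := by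
    intro w j
    have ht : (inner ℝ · (EuclideanSpace.single j (1 : ℝ)) : Eu n → ℝ).HasTemperateGrowth := by
      fun_prop
    rw [SchwartzMap.fourier_lineDerivOp_eq, smul_apply,
      SchwartzMap.smulLeftCLM_apply_apply ht]
    simp [EuclideanSpace.inner_single_right, abs_of_pos Real.pi_pos, mul_pow]
  have hscale : ∀ w : Eu n, F ((-(2 * Real.pi)) • w)
      = ∑ j : Fin n, ‖𝓕 (∂_{EuclideanSpace.single j (1 : ℝ)} G) w‖ ^ 2 := by
    intro w
    have h1 : ∫ ξ : Eu n, Complex.exp (Complex.I * ((⟪(-(2 * Real.pi)) • w, ξ⟫ : ℝ) : ℂ)) * G ξ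
        = 𝓕 G w := by
      rw [SchwartzMap.fourier_coe, Real.fourier_eq']
      refine integral_congr_ae (Filter.Eventually.of_forall fun ξ => ?_)
      simp only [inner_smul_left, real_inner_comm w ξ, smul_eq_mul]
      congr 2
      simp
      ring
    simp only [hF, hderiv, ← Finset.mul_sum, ← Finset.sum_mul]
    rw [h1, ← EuclideanSpace.norm_sq_eq, norm_smul, norm_neg, Real.norm_of_nonneg (by positivity)]
    ring
  have hpi : (0 : ℝ) < 2 * Real.pi := by positivity
  have hsub := Measure.integral_comp_smul (volume : Measure (Eu n)) F (-(2 * Real.pi))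
  rw [finrank_euclideanSpace_fin, abs_inv, abs_pow, abs_neg, abs_of_pos hpi, smul_eq_mul,
    eq_inv_mul_iff_mul_eq₀ (by positivity)] at hsub
  rw [← hsub]
  simp only [hscale]
  simp only [← SchwartzMap.lineDerivOp_apply_eq_fderiv]
  rw [integral_finsetSum _ fun j _ => hint _, integral_finsetSum _ fun j _ => hint _]
  simp only [SchwartzMap.integral_norm_sq_fourier]

theorem norm_toLp_apply_single {n : ℕ} (L : Eu n →L[ℝ] ℝ) (c : ℂ) :
    ‖(WithLp.toLp 2 fun j : Fin n => ((L (EuclideanSpace.single j 1) : ℝ) : ℂ) * c :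
      EuclideanSpace ℂ (Fin n))‖ = ‖L‖ * ‖c‖ := by
  obtain ⟨v, rfl⟩ := (InnerProductSpace.toDual ℝ (Eu n)).surjective L
  rw [LinearIsometryEquiv.norm_map, ← sq_eq_sq₀ (by positivity) (by positivity), mul_pow,
    EuclideanSpace.norm_sq_eq, EuclideanSpace.norm_sq_eq, Finset.sum_mul]
  simp [InnerProductSpace.toDual_apply_apply, EuclideanSpace.inner_single_right, mul_pow]

/-- first-moment localization bound for a wave packet.  If `g` is
smooth, compactly supported in the ball `B(ξ₀, ρ)`, the operator norm of the Hessian of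
`φ` is bounded by `B` on that ball, and `u(x,t) = ∫ e^{i(x·ξ + tφ(ξ))} g(ξ) dξ`, then
`(∫ |x + t∇φ(ξ₀)|² |u(x,t)|² dx)^{1/2}
  ≤ (2π)^{n/2} (‖∇g‖_{L²} + |t| ρ B ‖g‖_{L²})`. -/
theorem wave_packet_first_moment (n : ℕ) (hn : 1 ≤ n)
    (ξ₀ : Eu n) (ρ : ℝ) (hρ : 0 < ρ)
    (g : Eu n → ℂ) (hg : ContDiff ℝ ∞ g) (hgc : HasCompactSupport g)
    (hgsupp : tsupport g ⊆ Metric.closedBall ξ₀ ρ)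
    (φ : Eu n → ℝ) (hφ : ContDiff ℝ ∞ φ) (B : ℝ)
    (hB : ∀ ξ ∈ Metric.closedBall ξ₀ ρ, ‖fderiv ℝ (fderiv ℝ φ) ξ‖ ≤ B)
    (t : ℝ) :
    Real.sqrt (∫ x : Eu n, ‖x + t • gradient φ ξ₀‖ ^ 2 *
        ‖∫ ξ : Eu n, Complex.exp (Complex.I * ((⟪x, ξ⟫ + t * φ ξ : ℝ) : ℂ)) * g ξ‖ ^ 2)
      ≤ (2 * Real.pi) ^ ((n : ℝ) / 2) *
          (Real.sqrt (∫ ξ : Eu n,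
              ∑ j : Fin n, ‖fderiv ℝ g ξ (EuclideanSpace.single j 1)‖ ^ 2)
            + |t| * ρ * B * Real.sqrt (∫ ξ : Eu n, ‖g ξ‖ ^ 2)) := by
  set A : Eu n →L[ℝ] ℝ := fderiv ℝ φ ξ₀ with hA
  set ψ : Eu n → ℝ := fun ξ => t * (φ ξ - A ξ) with hψ
  set G : Eu n → ℂ := fun ξ => Complex.exp (Complex.I * (ψ ξ : ℂ)) * g ξ with hG
  have hψs : ContDiff ℝ ∞ ψ := contDiff_const.mul (hφ.sub A.contDiff)
  have hGs : ContDiff ℝ ∞ G :=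
    (contDiff_const.mul (Complex.ofRealCLM.contDiff.comp hψs)).cexp.mul hg
  have hGc : HasCompactSupport G := hgc.mul_left
  have hφd : Differentiable ℝ φ := hφ.differentiable (by simp)
  have hφd' : Differentiable ℝ (fderiv ℝ φ) :=
    (hφ.fderiv_right (m := ∞) (by simp)).differentiable (by simp)
  have hgd : Differentiable ℝ g := hg.differentiable (by simp)
  have hψd : ∀ ξ, HasFDerivAt ψ (t • (fderiv ℝ φ ξ - A)) ξ := fun ξ =>
    (((hφd ξ).hasFDerivAt).sub A.hasFDerivAt).const_mul t
  set D : Eu n → EuclideanSpace ℂ (Fin n) := fun ξ =>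
    WithLp.toLp 2 fun j => fderiv ℝ g ξ (EuclideanSpace.single j 1) with hD
  set K : Eu n → EuclideanSpace ℂ (Fin n) := fun ξ =>
    WithLp.toLp 2 fun j =>
      ((fderiv ℝ ψ ξ (EuclideanSpace.single j 1) : ℝ) : ℂ) * (Complex.I * g ξ) with hK
  have hB0 : 0 ≤ B := le_trans (by positivity) (hB ξ₀ (Metric.mem_closedBall_self hρ.le))
  have hgrad : ∀ ξ, ∑ j : Fin n, ‖fderiv ℝ G ξ (EuclideanSpace.single j 1)‖ ^ 2
      = ‖D ξ + K ξ‖ ^ 2 := by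
    intro ξ
    rw [EuclideanSpace.norm_sq_eq]
    refine Finset.sum_congr rfl fun j _ => ?_
    have h1 : HasFDerivAt (fun ξ => (ψ ξ : ℂ)) (Complex.ofRealCLM.comp (fderiv ℝ ψ ξ)) ξ :=
      Complex.ofRealCLM.hasFDerivAt.comp ξ (hψd ξ).differentiableAt.hasFDerivAt
    have h2 := ((h1.const_mul Complex.I).cexp.mul (hgd ξ).hasFDerivAt).fderiv
    have h3 : fderiv ℝ G ξ (EuclideanSpace.single j 1)
        = Complex.exp (Complex.I * (ψ ξ : ℂ)) * (D ξ + K ξ) j := by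
      refine (congrArg (fun L => L (EuclideanSpace.single j 1)) h2).trans ?_
      simp [hD, hK]
      ring
    rw [h3, norm_mul, mul_comm Complex.I, Complex.norm_exp_ofReal_mul_I, one_mul]
  have hKle : ∀ ξ, ‖K ξ‖ ^ 2 ≤ (|t| * ρ * B) ^ 2 * ‖g ξ‖ ^ 2 := by
    intro ξ
    rw [← mul_pow]
    refine pow_le_pow_left₀ (norm_nonneg _) ?_ 2
    rw [hK, norm_toLp_apply_single, norm_mul, Complex.norm_I, one_mul]
    by_cases hξ : ξ ∈ Metric.closedBall ξ₀ ρ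
    · gcongr
      rw [(hψd ξ).fderiv, norm_smul, Real.norm_eq_abs, mul_assoc]
      gcongr
      have := (convex_closedBall ξ₀ ρ).norm_image_sub_le_of_norm_fderiv_le
        (fun x _ => hφd' x) hB
        (Metric.mem_closedBall_self hρ.le) hξ
      refine this.trans ?_
      rw [mul_comm]
      gcongr
      exact mem_closedBall_iff_norm.1 hξ
    · have : g ξ = 0 := image_eq_zero_of_notMem_tsupport fun h => hξ (hgsupp h)
      simp [this]
  have hDL : MemLp D 2 := by
    refine Continuous.memLp_of_hasCompactSupport ?_ ?_
    · refine (PiLp.continuous_toLp 2 _).comp (continuous_pi fun j => ?_)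
      exact (hg.continuous_fderiv (by simp)).clm_apply continuous_const
    · refine (hgc.fderiv ℝ).mono' ?_
      refine Function.support_subset_iff'.2 fun ξ hξ => ?_
      ext j
      simp [hD, image_eq_zero_of_notMem_tsupport hξ]
  have hKL : MemLp K 2 := by
    refine Continuous.memLp_of_hasCompactSupport ?_ ?_
    · refine (PiLp.continuous_toLp 2 _).comp (continuous_pi fun j => ?_)
      exact (Complex.continuous_ofReal.comp ((hψs.continuous_fderiv (by simp)).clm_apply
        continuous_const)).mul (continuous_const.mul hg.continuous)
    · refine hgc.mono' ?_
      refine Function.support_subset_iff'.2 fun ξ hξ => ?_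
      ext j
      simp [hK, image_eq_zero_of_notMem_tsupport hξ]
  have hshift : ∀ x ξ : Eu n,
      Complex.exp (Complex.I * ((⟪x, ξ⟫ + t * φ ξ : ℝ) : ℂ)) * g ξ
        = Complex.exp (Complex.I * ((⟪x + t • gradient φ ξ₀, ξ⟫ : ℝ) : ℂ)) * G ξ := by
    intro x ξ
    have h1 : ⟪gradient φ ξ₀, ξ⟫ = A ξ := by simp [gradient, hA]
    have h2 : ⟪x, ξ⟫ + t * φ ξ = ⟪x + t • gradient φ ξ₀, ξ⟫ + ψ ξ := by
      simp only [inner_add_left, real_inner_smul_left, h1, hψ]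
      ring
    rw [h2, Complex.ofReal_add, mul_add, Complex.exp_add, mul_assoc]
  simp only [hshift]
  rw [integral_add_right_eq_self (μ := volume) (fun y : Eu n => ‖y‖ ^ 2 *
      ‖∫ ξ : Eu n, Complex.exp (Complex.I * ((⟪y, ξ⟫ : ℝ) : ℂ)) * G ξ‖ ^ 2),
    show G = hGc.toSchwartzMap hGs from rfl, integral_norm_sq_mul_norm_sq_integral_exp]
  change Real.sqrt (_ * ∫ ξ, ∑ j : Fin n, ‖fderiv ℝ G ξ _‖ ^ 2) ≤ _
  simp only [hgrad]
  rw [Real.sqrt_mul (by positivity), Real.sqrt_eq_rpow ((2 * Real.pi) ^ n), ← Real.rpow_natCast,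
    ← Real.rpow_mul (by positivity), mul_one_div]
  gcongr
  refine (sqrt_integral_norm_sq_add_le hDL hKL).trans ?_
  refine add_le_add ?_ ?_
  · simp [hD, EuclideanSpace.norm_sq_eq]
  · rw [← Real.sqrt_sq (by positivity : 0 ≤ |t| * ρ * B), ← Real.sqrt_mul (by positivity),
      ← integral_const_mul]
    refine Real.sqrt_le_sqrt (integral_mono (hKL.integrable_norm_pow (by norm_num)) ?_ hKle)
    exact ((hg.continuous.memLp_of_hasCompactSupport hgc (p := 2)).integrable_norm_pow
      (by norm_num)).const_mul _
end
end
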